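/- arXiv:2112.07058 — 2 statements merged into one kernel-verified Lean document; each statement's English description precedes it below -/
import Mathlib

section
/- The only rational points on the elliptic curve y² = (x − 3)(x − 4)(x − 12) over ℚ, besides the point at infinity, are (3, 0), (4, 0) and (12, 0). Equivalently: for all rational x, y with y² = (x − 3)(x − 4)(x − 12), one has y = 0 and x ∈ {3, 4, 12}. -/
theorem Int.exists_eq_sq_of_isCoprime_of_nonneg {x y z : ℤ} (hxy : IsCoprime x y)
    (h : x * y = z ^ 2) (hx : 0 ≤ x) : ∃ t : ℤ, x = t ^ 2 := by
  obtain ⟨t, ht | ht⟩ := Int.sq_of_isCoprime hxy h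
  · exact ⟨t, ht⟩
  · exact ⟨0, by nlinarith [sq_nonneg t]⟩

theorem Int.three_dvd_of_three_dvd_sq_add_sq {x y : ℤ} (h : (3 : ℤ) ∣ x ^ 2 + y ^ 2) :
    (3 : ℤ) ∣ x ∧ (3 : ℤ) ∣ y := by
  have h0 := Int.emod_eq_zero_of_dvd h
  have h1 : x % 3 = 0 ∨ x % 3 = 1 ∨ x % 3 = 2 := by omega
  have h2 : y % 3 = 0 ∨ y % 3 = 1 ∨ y % 3 = 2 := by omega
  rcases h1 with h1 | h1 | h1 <;> rcases h2 with h2 | h2 | h2 <;>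
    simp [pow_two, Int.add_emod, Int.mul_emod, h1, h2] at h0
  exact ⟨Int.dvd_of_emod_eq_zero h1, Int.dvd_of_emod_eq_zero h2⟩

theorem Int.emod_sixteen_sq_of_even {x : ℤ} (h : x % 2 = 0) :
    x ^ 2 % 16 = 0 ∨ x ^ 2 % 16 = 4 := by
  have h1 : x % 16 = 0 ∨ x % 16 = 2 ∨ x % 16 = 4 ∨ x % 16 = 6 ∨ x % 16 = 8 ∨ x % 16 = 10 ∨
    x % 16 = 12 ∨ x % 16 = 14 := by omega
  rcases h1 with h1 | h1 | h1 | h1 | h1 | h1 | h1 | h1 <;> simp [pow_two, Int.mul_emod, h1]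

theorem Int.emod_sixteen_sq_of_odd {x : ℤ} (h : x % 2 = 1) :
    x ^ 2 % 16 = 1 ∨ x ^ 2 % 16 = 9 := by
  have h1 : x % 16 = 1 ∨ x % 16 = 3 ∨ x % 16 = 5 ∨ x % 16 = 7 ∨ x % 16 = 9 ∨ x % 16 = 11 ∨
    x % 16 = 13 ∨ x % 16 = 15 := by omega
  rcases h1 with h1 | h1 | h1 | h1 | h1 | h1 | h1 | h1 <;> simp [pow_two, Int.mul_emod, h1]

/-- Two integers whose product is a nonzero square have a common square class, represented by
a common divisor. -/
theorem Int.exists_common_square_class {x y z : ℤ} (h : x * y = z ^ 2) (hz : z ≠ 0) :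
    ∃ d s t : ℤ, d ∣ x ∧ d ∣ y ∧ x = d * s ^ 2 ∧ y = d * t ^ 2 := by
  have hx : x ≠ 0 := by rintro rfl; apply hz; simpa using h.symm
  have hg : (0 : ℤ) < Int.gcd x y := by exact_mod_cast Int.gcd_pos_of_ne_zero_left y hx
  obtain ⟨x', y', hc, hx', hy'⟩ := Int.exists_gcd_one (m := x) (n := y) (by exact_mod_cast hg)
  set g : ℤ := (Int.gcd x y : ℤ)
  have hc' : IsCoprime x' y' := Int.isCoprime_iff_gcd_eq_one.mpr hc
  have hgz : g ∣ z := by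
    rw [← Int.pow_dvd_pow_iff two_ne_zero, ← h]
    exact ⟨x' * y', by rw [hx', hy']; ring⟩
  obtain ⟨w, rfl⟩ := hgz
  have hw : x' * y' = w ^ 2 := by
    apply mul_left_cancel₀ (pow_ne_zero 2 hg.ne')
    calc g ^ 2 * (x' * y') = (x' * g) * (y' * g) := by ring
      _ = g ^ 2 * w ^ 2 := by rw [← hx', ← hy', h]; ring
  have hw0 : 0 < w ^ 2 := by
    have : w ≠ 0 := by rintro rfl; simp at hz
    positivity
  have hgx : g ∣ x := ⟨x', by rw [hx']; ring⟩
  have hgy : g ∣ y := ⟨y', by rw [hy']; ring⟩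
  rcases le_total 0 x' with hpos | hneg
  · have hpos' : 0 ≤ y' := by by_contra! hlt; nlinarith
    obtain ⟨s, hs⟩ := Int.exists_eq_sq_of_isCoprime_of_nonneg hc' hw hpos
    obtain ⟨t, ht⟩ := Int.exists_eq_sq_of_isCoprime_of_nonneg hc'.symm
      ((mul_comm _ _).trans hw) hpos'
    exact ⟨g, s, t, hgx, hgy, by rw [← hs, hx']; ring, by rw [← ht, hy']; ring⟩
  · have hneg' : y' ≤ 0 := by by_contra! hlt; nlinarith
    obtain ⟨s, hs⟩ := Int.exists_eq_sq_of_isCoprime_of_nonneg (x := -x') (y := -y') (z := w)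
      hc'.neg_neg (by rw [← hw]; ring) (by linarith)
    obtain ⟨t, ht⟩ := Int.exists_eq_sq_of_isCoprime_of_nonneg (x := -y') (y := -x') (z := w)
      hc'.symm.neg_neg (by rw [← hw]; ring) (by linarith)
    exact ⟨-g, s, t, (neg_dvd).mpr hgx, (neg_dvd).mpr hgy,
      by rw [← hs, hx']; ring, by rw [← ht, hy']; ring⟩

theorem Int.exists_factorization_of_mul_eq_mul {m n k l : ℤ} (h : m * n = k * l) (hm : m ≠ 0) :
    ∃ a b c d : ℤ, m = a * b ∧ n = c * d ∧ k = a * c ∧ l = b * d ∧ IsCoprime b c := by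
  have hg : (0 : ℤ) < Int.gcd m k := by exact_mod_cast Int.gcd_pos_of_ne_zero_left k hm
  obtain ⟨b, c, hc, hb', hc'⟩ := Int.exists_gcd_one (m := m) (n := k) (by exact_mod_cast hg)
  set g : ℤ := (Int.gcd m k : ℤ)
  have hbc : IsCoprime b c := Int.isCoprime_iff_gcd_eq_one.mpr hc
  have h1 : b * n = c * l := by
    apply mul_left_cancel₀ hg.ne'
    calc g * (b * n) = (b * g) * n := by ring
      _ = (c * g) * l := by rw [← hb', ← hc', h]
      _ = g * (c * l) := by ring
  obtain ⟨d, rfl⟩ : c ∣ n := hbc.symm.dvd_of_dvd_mul_left ⟨l, h1⟩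
  obtain ⟨d', hd'⟩ : b ∣ l := hbc.dvd_of_dvd_mul_left ⟨c * d, h1.symm⟩
  rcases eq_or_ne c 0 with rfl | hc0
  · exact ⟨g, b, 0, d', by rw [hb']; ring, by ring, by rw [hc']; ring, hd', hbc⟩
  · refine ⟨g, b, c, d, by rw [hb']; ring, rfl, by rw [hc']; ring, ?_, hbc⟩
    apply mul_left_cancel₀ hc0
    rw [← h1]; ring

/-- The descent step: when `(3m ± n)²` and `(k ± l)²` are four distinct squares in arithmetic
progression, some divisor `s` of `m * n` solves the pair of equations again. -/
theorem exists_smaller_concordant {m n k l : ℤ} (hpq : IsCoprime (3 * m) n)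
    (hmn : m * n = k * l) (hsq : 9 * m ^ 2 + n ^ 2 = k ^ 2 + l ^ 2) (h0 : m * n ≠ 0) :
    ∃ r s u v : ℤ, s ≠ 0 ∧ s ∣ m * n ∧ r ^ 2 - s ^ 2 = u ^ 2 ∧ r ^ 2 - 9 * s ^ 2 = v ^ 2 := by
  obtain ⟨a, b, c, d, rfl, rfl, rfl, rfl, hbc⟩ :=
    Int.exists_factorization_of_mul_eq_mul hmn (left_ne_zero_of_mul h0)
  have ha : a ≠ 0 := by rintro rfl; simp at h0
  have hb : b ≠ 0 := by rintro rfl; simp at h0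
  have hd : d ≠ 0 := by rintro rfl; simp at h0
  have had : IsCoprime a d := hpq.of_mul_left_right.of_mul_left_left.of_mul_right_right
  have h3c : IsCoprime 3 c := hpq.of_mul_left_left.of_mul_right_left
  have h3 : ∀ {x y : ℤ}, (3 : ℤ) * x = c ^ 2 + y ^ 2 → False := by
    intro x y hxy
    have := (Int.three_dvd_of_three_dvd_sq_add_sq ⟨x, hxy.symm⟩).1
    have := h3c.isUnit_of_dvd' dvd_rfl this
    rw [Int.isUnit_iff] at this
    omega
  have key : a ^ 2 * (9 * b ^ 2 - c ^ 2) = d ^ 2 * (b ^ 2 - c ^ 2) := by linarith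
  obtain ⟨e, he⟩ : d ^ 2 ∣ 9 * b ^ 2 - c ^ 2 :=
    (had.symm.pow : IsCoprime (d ^ 2) (a ^ 2)).dvd_of_dvd_mul_left ⟨_, key⟩
  have he' : b ^ 2 - c ^ 2 = a ^ 2 * e := by
    apply mul_left_cancel₀ (pow_ne_zero 2 hd)
    rw [← key, he]; ring
  have he8 : e ∣ 8 := by
    obtain ⟨f, g, hfg⟩ : IsCoprime (b ^ 2) (c ^ 2) := hbc.pow
    refine ⟨f * (d ^ 2 - a ^ 2) + g * (d ^ 2 - 9 * a ^ 2), ?_⟩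
    linear_combination (-8) * hfg + (f + g) * he + (-f - 9 * g) * he'
  have heven : ∀ j, e = 2 * j → e ∣ 4 → False := by
    rintro j rfl hj4
    have hpar : b % 2 = 1 ∧ c % 2 = 1 := by
      have hbc2 : (b ^ 2 - c ^ 2) % 2 = 0 := by
        rw [he', show a ^ 2 * (2 * j) = 2 * (a ^ 2 * j) by ring]; omega
      have hnb : ¬ (b % 2 = 0 ∧ c % 2 = 0) := by
        rintro ⟨h1, h2⟩
        have := hbc.isUnit_of_dvd' (Int.dvd_of_emod_eq_zero h1) (Int.dvd_of_emod_eq_zero h2)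
        rw [Int.isUnit_iff] at this
        omega
      rcases Int.emod_two_eq_zero_or_one b with h1 | h1 <;>
        rcases Int.emod_two_eq_zero_or_one c with h2 | h2 <;>
        simp [pow_two, Int.sub_emod, Int.mul_emod, h1, h2] at hbc2 hnb ⊢
    have hb8 := Int.emod_sixteen_sq_of_odd hpar.1
    have hc8 := Int.emod_sixteen_sq_of_odd hpar.2
    have hnad : ¬ (a % 2 = 0 ∧ d % 2 = 0) := by
      rintro ⟨h1, h2⟩
      have := had.isUnit_of_dvd' (Int.dvd_of_emod_eq_zero h1) (Int.dvd_of_emod_eq_zero h2)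
      rw [Int.isUnit_iff] at this
      omega
    obtain ⟨i, hi⟩ := hj4
    have h4a : (a ^ 2) % 2 = 0 := by
      have : a ^ 2 * 4 = (b ^ 2 - c ^ 2) * i := by rw [he', hi]; ring
      obtain ⟨t, ht⟩ : (8 : ℤ) ∣ b ^ 2 - c ^ 2 := by omega
      rw [ht, mul_assoc] at this
      omega
    have h4d : (d ^ 2) % 2 = 0 := by
      have : d ^ 2 * 4 = (9 * b ^ 2 - c ^ 2) * i := by rw [he, hi]; ring
      obtain ⟨t, ht⟩ : (8 : ℤ) ∣ 9 * b ^ 2 - c ^ 2 := by omega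
      rw [ht, mul_assoc] at this
      omega
    apply hnad
    constructor
    · exact Int.even_iff.mp ((Int.even_pow.mp (Int.even_iff.mpr h4a)).1)
    · exact Int.even_iff.mp ((Int.even_pow.mp (Int.even_iff.mpr h4d)).1)
  have hle := Int.le_of_dvd (by norm_num) he8
  have hge := Int.le_of_dvd (by norm_num) (neg_dvd.mpr he8)
  have hge' : -8 ≤ e := by linarith
  interval_cases e <;> try exact absurd he8 (by decide)
  · exact (h3 (x := 3 * b ^ 2 + 3 * d ^ 2) (y := d) (by linarith)).elim
  · exact (heven (-2) (by norm_num) (by norm_num)).elim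
  · exact (heven (-1) (by norm_num) (by norm_num)).elim
  · exact ⟨c, b, a, d, hb, ⟨a * (c * d), by ring⟩, by linarith, by linarith⟩
  · exact (h3 (x := 3 * b ^ 2) (y := d) (by linarith)).elim
  · exact (heven 1 (by norm_num) (by norm_num)).elim
  · exact (heven 2 (by norm_num) (by norm_num)).elim
  · exact ⟨d, a, b, c, ha, ⟨b * (c * d), by ring⟩, by linarith, by linarith⟩

theorem exists_smaller_concordant_of_isCoprime {r s u v : ℤ} (hs : s ≠ 0) (hrs : IsCoprime r s)
    (hu : r ^ 2 - s ^ 2 = u ^ 2) (hv : r ^ 2 - 9 * s ^ 2 = v ^ 2) :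
    ∃ r' s' u' v' : ℤ, s' ≠ 0 ∧ s'.natAbs < s.natAbs ∧
      r' ^ 2 - s' ^ 2 = u' ^ 2 ∧ r' ^ 2 - 9 * s' ^ 2 = v' ^ 2 := by
  wlog hr : 0 ≤ r generalizing r
  · exact this hrs.neg_left (by rwa [neg_sq]) (by rwa [neg_sq]) (by linarith)
  have hnn : ¬ (r % 2 = 0 ∧ s % 2 = 0) := by
    rintro ⟨h1, h2⟩
    have := hrs.isUnit_of_dvd' (Int.dvd_of_emod_eq_zero h1) (Int.dvd_of_emod_eq_zero h2)
    rw [Int.isUnit_iff] at this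
    omega
  have hpar : r % 2 = 1 ∧ s % 2 = 0 := by
    have sq16 : ∀ x : ℤ, (x % 2 = 0 ∧ (x ^ 2 % 16 = 0 ∨ x ^ 2 % 16 = 4)) ∨
        (x % 2 = 1 ∧ (x ^ 2 % 16 = 1 ∨ x ^ 2 % 16 = 9)) := fun x =>
      (Int.emod_two_eq_zero_or_one x).imp (fun h => ⟨h, Int.emod_sixteen_sq_of_even h⟩)
        (fun h => ⟨h, Int.emod_sixteen_sq_of_odd h⟩)
    have h1 := sq16 r
    have h2 := sq16 s
    have h3 := sq16 u
    have h4 := sq16 v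
    generalize r ^ 2 = R at *
    generalize s ^ 2 = S at *
    generalize u ^ 2 = U at *
    generalize v ^ 2 = V at *
    omega
  have h3r : IsCoprime r 3 := by
    refine ((Int.prime_three.coprime_iff_not_dvd).mpr ?_).symm
    intro h
    have h' : (3 : ℤ) ∣ s ^ 2 + u ^ 2 := by
      rw [← hu, add_sub_cancel]; exact dvd_pow h two_ne_zero
    have := hrs.isUnit_of_dvd' h (Int.three_dvd_of_three_dvd_sq_add_sq h').1
    rw [Int.isUnit_iff] at this
    omega
  have hr3s : IsCoprime r (3 * s) := h3r.mul_right hrs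
  have two_coprime : ∀ {x : ℤ}, x % 2 = 1 → IsCoprime x 2 := fun {x} hx =>
    ⟨1, -(x / 2), by omega⟩
  have hdiff : ∀ {t : ℤ}, IsCoprime r t → t % 2 = 0 → IsCoprime (r - t) (r + t) := by
    intro t ht ht2
    have h1 : IsCoprime (r - t) r := by
      have := ht.symm.neg_left.add_mul_right_left 1
      rwa [show -t + 1 * r = r - t by ring] at this
    have h2 : IsCoprime (r - t) (2 * r) := (two_coprime (by omega)).mul_right h1
    have := h2.add_mul_left_right (-1)
    rwa [show 2 * r + (r - t) * -1 = r + t by ring] at this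
  have hbound : |3 * s| ≤ |r| := by
    apply sq_le_sq.mp
    nlinarith [sq_nonneg v]
  rw [abs_of_nonneg hr, abs_le] at hbound
  have c1 := hdiff hrs hpar.2
  have c3 := hdiff hr3s (by omega)
  have e1 : (r - s) * (r + s) = u ^ 2 := by rw [← hu]; ring
  have e3 : (r - 3 * s) * (r + 3 * s) = v ^ 2 := by rw [← hv]; ring
  obtain ⟨A, hA⟩ := Int.exists_eq_sq_of_isCoprime_of_nonneg c3 e3 (by linarith)
  obtain ⟨D, hD⟩ := Int.exists_eq_sq_of_isCoprime_of_nonneg c3.symm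
    ((mul_comm _ _).trans e3) (by linarith)
  obtain ⟨B, hB⟩ := Int.exists_eq_sq_of_isCoprime_of_nonneg c1 e1 (by linarith)
  obtain ⟨C, hC⟩ := Int.exists_eq_sq_of_isCoprime_of_nonneg c1.symm
    ((mul_comm _ _).trans e1) (by linarith)
  have odd_of_sq : ∀ {x t : ℤ}, t = x ^ 2 → t % 2 = 1 → x % 2 = 1 := by
    rintro x _ rfl h
    rcases Int.emod_two_eq_zero_or_one x with h1 | h1
    · simp [pow_two, Int.mul_emod, h1] at h
    · exact h1
  have oA := odd_of_sq hA (by omega)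
  have oB := odd_of_sq hB (by omega)
  have oC := odd_of_sq hC (by omega)
  have oD := odd_of_sq hD (by omega)
  obtain ⟨p, hp⟩ : ∃ p, D + A = 2 * p := ⟨(D + A) / 2, by omega⟩
  obtain ⟨P, hP⟩ : ∃ P, C + B = 2 * P := ⟨(C + B) / 2, by omega⟩
  obtain ⟨q, rfl⟩ : ∃ q, A = p - q := ⟨p - A, by ring⟩
  obtain ⟨Q, rfl⟩ : ∃ Q, B = P - Q := ⟨P - B, by ring⟩
  obtain rfl : D = p + q := by linarith
  obtain rfl : C = P + Q := by linarith
  have hpq2 : 2 * (p * q) = 3 * s := by linarith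
  have hPQ2 : 2 * (P * Q) = s := by linarith
  have hprod : p * q = 3 * (P * Q) := by linarith
  have hsum : p ^ 2 + q ^ 2 = P ^ 2 + Q ^ 2 := by linarith
  have hcop : IsCoprime p q := by
    have hrpq : r = p ^ 2 + q ^ 2 := by linarith
    rw [hrpq, ← hpq2] at hr3s
    have h1 : IsCoprime (p * p + q ^ 2) p := by
      rw [← pow_two]; exact hr3s.of_mul_right_right.of_mul_right_left
    exact ((IsCoprime.pow_left_iff two_pos).mp h1.of_mul_add_left_left).symm
  have finish : ∀ m n : ℤ, IsCoprime (3 * m) n → m * n = P * Q →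
      9 * m ^ 2 + n ^ 2 = P ^ 2 + Q ^ 2 → ∃ r' s' u' v' : ℤ, s' ≠ 0 ∧ s'.natAbs < s.natAbs ∧
      r' ^ 2 - s' ^ 2 = u' ^ 2 ∧ r' ^ 2 - 9 * s' ^ 2 = v' ^ 2 := by
    intro m n h1 h2 h3
    have h0 : m * n ≠ 0 := by rw [h2]; intro h; apply hs; rw [← hPQ2, h]; rfl
    obtain ⟨r', s', u', v', g0, g1, g2, g3⟩ := exists_smaller_concordant h1 h2 h3 h0
    refine ⟨r', s', u', v', g0, ?_, g2, g3⟩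
    have := Nat.le_of_dvd (Int.natAbs_pos.mpr h0) (Int.natAbs_dvd_natAbs.mpr g1)
    rw [h2] at this h0
    omega
  rcases Int.prime_three.dvd_or_dvd (⟨_, hprod⟩ : (3 : ℤ) ∣ p * q) with ⟨m, rfl⟩ | ⟨m, rfl⟩
  · exact finish m q hcop (by linarith) (by linarith)
  · exact finish m p hcop.symm (by linarith) (by linarith)

/-- The forms `r² - s²` and `r² - 9s²` are simultaneously squares only for `s = 0`. -/
theorem eq_zero_of_concordant {r s u v : ℤ}
    (hu : r ^ 2 - s ^ 2 = u ^ 2) (hv : r ^ 2 - 9 * s ^ 2 = v ^ 2) : s = 0 := by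
  induction hN : s.natAbs using Nat.strong_induction_on generalizing r s u v with
  | _ N ih =>
    subst hN
    by_contra hs
    have hg : 0 < Int.gcd r s := Int.gcd_pos_of_ne_zero_right r hs
    obtain ⟨r', s', hc, hr', hs'⟩ := Int.exists_gcd_one hg
    have hg' : (0 : ℤ) < Int.gcd r s := by exact_mod_cast hg
    set g : ℤ := (Int.gcd r s : ℤ)
    obtain ⟨u', rfl⟩ : g ∣ u := by
      rw [← Int.pow_dvd_pow_iff two_ne_zero, ← hu]
      exact ⟨r' ^ 2 - s' ^ 2, by rw [hr', hs']; ring⟩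
    obtain ⟨v', rfl⟩ : g ∣ v := by
      rw [← Int.pow_dvd_pow_iff two_ne_zero, ← hv]
      exact ⟨r' ^ 2 - 9 * s' ^ 2, by rw [hr', hs']; ring⟩
    have hu' : r' ^ 2 - s' ^ 2 = u' ^ 2 := by
      apply mul_left_cancel₀ (pow_ne_zero 2 hg'.ne')
      rw [hr', hs'] at hu
      linarith
    have hv' : r' ^ 2 - 9 * s' ^ 2 = v' ^ 2 := by
      apply mul_left_cancel₀ (pow_ne_zero 2 hg'.ne')
      rw [hr', hs'] at hv
      linarith
    have hs0 : s' ≠ 0 := by rintro rfl; apply hs; rw [hs']; ring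
    obtain ⟨r₁, s₁, u₁, v₁, h0, hlt, h1, h2⟩ :=
      exists_smaller_concordant_of_isCoprime hs0 (Int.isCoprime_iff_gcd_eq_one.mpr hc) hu' hv'
    have hle : s'.natAbs ≤ s.natAbs :=
      Nat.le_of_dvd (Int.natAbs_pos.mpr hs) (Int.natAbs_dvd_natAbs.mpr ⟨g, hs'⟩)
    exact h0 (ih _ (hlt.trans_le hle) h1 h2 rfl)

theorem no_concordant_multiple {d α e β γ : ℤ} (hd : d ∣ 8) (hα : α ≠ 0) (he : e ≠ 0) (hβ : β ≠ 0)
    (hγ : γ ≠ 0) (h1 : α ^ 2 - e ^ 2 = d * β ^ 2) (h2 : α ^ 2 - 9 * e ^ 2 = d * γ ^ 2) : False := by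
  have hle := Int.le_of_dvd (by norm_num) hd
  have hge := Int.le_of_dvd (by norm_num) (neg_dvd.mpr hd)
  have hge' : -8 ≤ d := by linarith
  interval_cases d <;> try exact absurd hd (by decide)
  · exact hβ (eq_zero_of_concordant (r := γ) (s := β) (u := e) (v := α) (by linarith) (by linarith))
  · exact hα (eq_zero_of_concordant (r := 3 * e) (s := α) (u := 2 * γ) (v := 6 * β)
      (by linarith) (by linarith))
  · exact hβ (eq_zero_of_concordant (r := γ) (s := β) (u := 2 * e) (v := 2 * α)
      (by linarith) (by linarith))
  · exact hα (eq_zero_of_concordant (r := 3 * e) (s := α) (u := γ) (v := 3 * β)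
      (by linarith) (by linarith))
  · exact he (eq_zero_of_concordant (r := α) (s := e) (u := β) (v := γ) (by linarith) (by linarith))
  · exact hγ (eq_zero_of_concordant (r := 3 * β) (s := γ) (u := 2 * α) (v := 6 * e)
      (by linarith) (by linarith))
  · exact he (eq_zero_of_concordant (r := α) (s := e) (u := 2 * β) (v := 2 * γ)
      (by linarith) (by linarith))
  · exact hγ (eq_zero_of_concordant (r := 3 * β) (s := γ) (u := α) (v := 3 * e)
      (by linarith) (by linarith))

theorem no_integer_solution {u v w : ℤ} (hv : 0 < v) (huv : IsCoprime u v) (hw : w ≠ 0)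
    (h : u * v * (u - v) * (u - 9 * v) = w ^ 2) : False := by
  have cop_sub : ∀ k : ℤ, IsCoprime (u - k * v) v := fun k => by
    have := huv.add_mul_right_left (-k)
    rwa [show u + -k * v = u - k * v by ring] at this
  have c1 : IsCoprime (u - v) v := by simpa using cop_sub 1
  have hvc : IsCoprime v (u * (u - v) * (u - 9 * v)) :=
    ((huv.mul_left c1).mul_left (cop_sub 9)).symm
  have h' : v * (u * (u - v) * (u - 9 * v)) = w ^ 2 := by rw [← h]; ring
  obtain ⟨e, rfl⟩ := Int.exists_eq_sq_of_isCoprime_of_nonneg hvc h' hv.le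
  have he : e ≠ 0 := by rintro rfl; simp at hv
  obtain ⟨n, rfl⟩ : e ∣ w := by
    rw [← Int.pow_dvd_pow_iff two_ne_zero]; exact ⟨_, h'.symm⟩
  have hn : u * ((u - e ^ 2) * (u - 9 * e ^ 2)) = n ^ 2 := by
    apply mul_left_cancel₀ (pow_ne_zero 2 he); linarith
  have hn0 : n ≠ 0 := right_ne_zero_of_mul hw
  have hn2 : 0 < n ^ 2 := by positivity
  have hu : 0 < u := by
    by_contra! hle
    have : 0 ≤ (u - e ^ 2) * (u - 9 * e ^ 2) := by nlinarith
    nlinarith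
  obtain ⟨d, α, m, hdu, hdm, hα, hm⟩ := Int.exists_common_square_class hn hn0
  have hd9 : d ∣ 9 := by
    have h1 : d ∣ 9 * (e ^ 2) ^ 2 := by
      have := dvd_sub hdm (hdu.mul_right (u - 10 * e ^ 2))
      rwa [show (u - e ^ 2) * (u - 9 * e ^ 2) - u * (u - 10 * e ^ 2) = 9 * (e ^ 2) ^ 2 by ring] at this
    exact (huv.of_isCoprime_of_dvd_left hdu).pow_right.dvd_of_dvd_mul_right h1
  have hdpos : 0 < d := by by_contra! hle; nlinarith [sq_nonneg α]
  have hm0 : m ≠ 0 := by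
    rintro rfl
    simp only [ne_eq, OfNat.ofNat_ne_zero, not_false_eq_true, zero_pow, mul_zero] at hm
    rw [hm] at hn
    linarith
  obtain ⟨α, m, hα, hm, hm0⟩ : ∃ α m : ℤ, u = α ^ 2 ∧
      (u - e ^ 2) * (u - 9 * e ^ 2) = m ^ 2 ∧ m ≠ 0 := by
    have hle := Int.le_of_dvd (by norm_num) hd9
    interval_cases d <;> try exact absurd hd9 (by decide)
    · exact ⟨α, m, by linarith, by linarith, hm0⟩
    · exfalso
      have three_not_dvd : ¬ (3 : ℤ) ∣ e := fun h3 => by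
        have := huv.isUnit_of_dvd' hdu (dvd_pow h3 two_ne_zero)
        rw [Int.isUnit_iff] at this
        omega
      have hm' : (3 * α ^ 2 - e ^ 2) * (α ^ 2 - 3 * e ^ 2) = m ^ 2 := by
        rw [hα] at hm; linarith
      have h3 : (3 : ℤ) ∣ (e * α) ^ 2 + m ^ 2 :=
        ⟨α ^ 4 + e ^ 4 - 3 * (e * α) ^ 2, by rw [← hm']; ring⟩
      obtain ⟨heα, m', rfl⟩ := Int.three_dvd_of_three_dvd_sq_add_sq h3
      obtain ⟨α', rfl⟩ := (Int.prime_three.dvd_or_dvd heα).resolve_left three_not_dvd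
      have h4 : (3 : ℤ) ∣ e ^ 4 :=
        ⟨m' ^ 2 - 27 * α' ^ 4 + 10 * α' ^ 2 * e ^ 2, by linarith⟩
      exact three_not_dvd (Int.prime_three.dvd_of_dvd_pow h4)
    · exact ⟨3 * α, 3 * m, by linarith, by linarith, by omega⟩
  subst hα
  obtain ⟨d, β, γ, hd1, hd2, hβ, hγ⟩ := Int.exists_common_square_class hm hm0
  have hd8 : d ∣ 8 := by
    have h1 : d ∣ 8 * e ^ 2 := by
      have := dvd_sub hd1 hd2
      rwa [show α ^ 2 - e ^ 2 - (α ^ 2 - 9 * e ^ 2) = 8 * e ^ 2 by ring] at this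
    exact (c1.of_isCoprime_of_dvd_left hd1).dvd_of_dvd_mul_right h1
  refine no_concordant_multiple hd8 ?_ he ?_ ?_ hβ hγ
  · rintro rfl; simp at hu
  · rintro rfl; apply hm0; simpa [hβ] using hm.symm
  · rintro rfl; apply hm0; simpa [hγ] using hm.symm

/-- the only affine rational points on `y² = (x−3)(x−4)(x−12)`
are the three 2-torsion points `(3,0)`, `(4,0)`, `(12,0)`. -/
theorem rational_points_of_median_curve
    (x y : ℚ) (h : y ^ 2 = (x - 3) * (x - 4) * (x - 12)) :
    y = 0 ∧ (x = 3 ∨ x = 4 ∨ x = 12) := by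
  have hy : y = 0 := by
    by_contra hy
    obtain ⟨X, rfl⟩ : ∃ X : ℚ, x = X + 3 := ⟨x - 3, by ring⟩
    have hden : (X.den : ℚ) ≠ 0 := by exact_mod_cast X.den_nz
    have hN : (y * X.den ^ 2) ^ 2 =
        ((X.num * X.den * (X.num - X.den) * (X.num - 9 * X.den) : ℤ) : ℚ) := by
      push_cast
      rw [mul_pow, h]
      have hXd : X * X.den = X.num := Rat.mul_den_eq_num X
      rw [← hXd]; ring
    obtain ⟨w, hw⟩ : ∃ w : ℤ, (w : ℚ) = y * X.den ^ 2 := by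
      have : IsSquare ((X.num * X.den * (X.num - X.den) * (X.num - 9 * X.den) : ℤ) : ℚ) :=
        ⟨y * X.den ^ 2, by rw [← hN]; ring⟩
      obtain ⟨t, ht⟩ := Rat.isSquare_intCast_iff.mp this
      rw [ht] at hN
      push_cast at hN
      rw [← pow_two, sq_eq_sq_iff_eq_or_eq_neg] at hN
      rcases hN with hN | hN
      · exact ⟨t, hN.symm⟩
      · exact ⟨-t, by push_cast; exact hN.symm⟩
    rw [← hw] at hN
    refine no_integer_solution (u := X.num) (v := X.den) (w := w)
      (by exact_mod_cast X.den_pos) ?_ ?_ ?_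
    · exact Int.isCoprime_iff_gcd_eq_one.mpr X.reduced
    · rintro rfl
      have : y * (X.den : ℚ) ^ 2 ≠ 0 := mul_ne_zero hy (pow_ne_zero 2 hden)
      exact this (by rw [← hw]; simp)
    · exact_mod_cast hN.symm
  refine ⟨hy, ?_⟩
  rw [hy] at h
  have h' : (x - 3) * (x - 4) * (x - 12) = 0 := by rw [← h]; norm_num
  rcases mul_eq_zero.mp h' with h' | h'
  · rcases mul_eq_zero.mp h' with h' | h'
    · exact Or.inl (by linarith)
    · exact Or.inr (Or.inl (by linarith))
  · exact Or.inr (Or.inr (by linarith))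
end

section
/- Every rational solution (p, s) of the quartic equation s² = −4p⁴ + 5p² − 1 satisfies s = 0 and p ∈ {1, −1, 1/2, −1/2}. -/
theorem three_dvd_and_three_dvd_of_three_dvd_sq_add_sq {x y : ℤ} (h : 3 ∣ x ^ 2 + y ^ 2) :
    3 ∣ x ∧ 3 ∣ y := by
  have hx : x % 3 = 0 ∨ x % 3 = 1 ∨ x % 3 = 2 := by omega
  have hy : y % 3 = 0 ∨ y % 3 = 1 ∨ y % 3 = 2 := by omega
  have hmod := Int.emod_eq_zero_of_dvd h
  rcases hx with hx | hx | hx <;> rcases hy with hy | hy | hy <;>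
    simp [pow_two, Int.add_emod, Int.mul_emod, hx, hy] at hmod <;> omega

theorem not_isCoprime_of_three_dvd {x y : ℤ} (hx : 3 ∣ x) (hy : 3 ∣ y) : ¬IsCoprime x y := by
  intro h
  have := Int.isUnit_iff.mp (h.isUnit_of_dvd' hx hy)
  omega

/-- The descent step for the pair of forms `x² + y²` and `x² + 4y²`. -/
theorem exists_smaller_concordant_pair {m n p q : ℤ} (hmn : IsCoprime m n) (hm : m ≠ 0)
    (hn : n ≠ 0) (hp : p % 2 = 1) (hq : q % 2 = 0) (hsub : m ^ 2 - n ^ 2 = p ^ 2 - q ^ 2)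
    (hmul : p * q = 2 * m * n) :
    ∃ x y a b : ℤ, x % 2 = 1 ∧ IsCoprime x y ∧ y ≠ 0 ∧ y.natAbs ≤ n.natAbs ∧
      x ^ 2 + y ^ 2 = a ^ 2 ∧ x ^ 2 + 4 * y ^ 2 = b ^ 2 := by
  obtain ⟨r, rfl⟩ := Int.dvd_of_emod_eq_zero hq
  have hr : p * r = m * n := by linarith
  obtain ⟨α, γ, ⟨β, rfl⟩, ⟨δ, rfl⟩, rfl⟩ := exists_dvd_and_dvd_of_dvd_mul ⟨r, hr.symm⟩
  have hα : α ≠ 0 := left_ne_zero_of_mul hm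
  have hβ : β ≠ 0 := right_ne_zero_of_mul hm
  have hγ : γ ≠ 0 := left_ne_zero_of_mul hn
  have hδ : δ ≠ 0 := right_ne_zero_of_mul hn
  obtain rfl : r = β * δ := mul_left_cancel₀ (mul_ne_zero hα hγ) (by linarith)
  have hαδ : IsCoprime α δ := hmn.of_mul_left_left.of_mul_right_right
  have hβγ : IsCoprime β γ := hmn.of_mul_left_right.of_mul_right_left
  have hodd : α % 2 = 1 := by
    rcases Int.emod_two_eq_zero_or_one α with h | h
    · simp [Int.mul_emod, h] at hp
    · exact h
  have hbal : α ^ 2 * (β ^ 2 - γ ^ 2) = δ ^ 2 * (γ ^ 2 - 4 * β ^ 2) := by linarith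
  obtain ⟨k, hk⟩ : δ ^ 2 ∣ β ^ 2 - γ ^ 2 :=
    (hαδ.symm.pow (m := 2) (n := 2)).dvd_of_dvd_mul_left ⟨_, hbal⟩
  have hk' : γ ^ 2 - 4 * β ^ 2 = α ^ 2 * k := by
    apply mul_left_cancel₀ (pow_ne_zero 2 hδ)
    rw [← hbal, hk]
    ring
  have hβk : 3 * β ^ 2 = k * -(α ^ 2 + δ ^ 2) := by linarith
  have hγk : 3 * γ ^ 2 = k * -(α ^ 2 + 4 * δ ^ 2) := by linarith
  have hk3 : k ∣ 3 := by
    obtain ⟨s, t, hst⟩ := hβγ.pow (m := 2) (n := 2)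
    refine ⟨s * -(α ^ 2 + δ ^ 2) + t * -(α ^ 2 + 4 * δ ^ 2), ?_⟩
    linear_combination (-3) * hst + s * hβk + t * hγk
  have hα2 : 0 < α ^ 2 := by positivity
  have hβ2 : 0 < β ^ 2 := by positivity
  have hδ2 : 0 < δ ^ 2 := by positivity
  have hkneg : k < 0 := by
    by_contra! h
    nlinarith
  have hkle : -3 ≤ k := by
    have := Int.le_of_dvd (by norm_num) ((neg_dvd).mpr hk3)
    linarith
  have hk_cases : k = -1 ∨ k = -3 := by
    interval_cases k <;> revert hk3 <;> decide
  rcases hk_cases with rfl | rfl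
  · obtain ⟨h₁, h₂⟩ :=
      three_dvd_and_three_dvd_of_three_dvd_sq_add_sq (x := α) (y := δ) ⟨β ^ 2, by linarith⟩
    exact absurd hαδ (not_isCoprime_of_three_dvd h₁ h₂)
  · refine ⟨α, δ, β, γ, hodd, hαδ, hδ, ?_, by linarith, by linarith⟩
    exact Nat.le_of_dvd (Int.natAbs_pos.mpr hn) (Int.natAbs_dvd_natAbs.mpr (Dvd.intro_left γ rfl))

theorem eq_zero_of_concordant_of_odd {x y a b : ℤ} (hx : x % 2 = 1) (hxy : IsCoprime x y)
    (ha : x ^ 2 + y ^ 2 = a ^ 2) (hb : x ^ 2 + 4 * y ^ 2 = b ^ 2) : y = 0 := by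
  induction hN : y.natAbs using Nat.strong_induction_on generalizing x y a b with
  | _ N ih =>
  by_contra hy
  subst hN
  have hx0 : x ≠ 0 := by
    rintro rfl
    norm_num at hx
  have hx2 : 0 < x ^ 2 := by positivity
  have ha0 : 0 < |a| := abs_pos.mpr (by rintro rfl; nlinarith [sq_nonneg y])
  have hb0 : 0 < |b| := abs_pos.mpr (by rintro rfl; nlinarith [sq_nonneg y])
  have hx2y : IsCoprime x (2 * y) :=
    IsCoprime.mul_right ⟨1, -(x / 2), by omega⟩ hxy
  have hta : PythagoreanTriple x y |a| := by
    unfold PythagoreanTriple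
    rw [abs_mul_abs_self]
    linarith
  have htb : PythagoreanTriple x (2 * y) |b| := by
    unfold PythagoreanTriple
    rw [abs_mul_abs_self]
    linarith
  obtain ⟨m, n, hxm, hym, -, hmn, -, -⟩ :=
    hta.coprime_classification' (Int.isCoprime_iff_gcd_eq_one.mp hxy) hx ha0
  obtain ⟨p, q, hxp, hyp, -, -, hpq, -⟩ :=
    htb.coprime_classification' (Int.isCoprime_iff_gcd_eq_one.mp hx2y) hx hb0
  have hmn' : IsCoprime m n := Int.isCoprime_iff_gcd_eq_one.mpr hmn
  have hm : m ≠ 0 := by rintro rfl; simp at hym; exact hy hym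
  have hn : n ≠ 0 := by rintro rfl; simp at hym; exact hy hym
  have hm' : 0 < m.natAbs := Int.natAbs_pos.mpr hm
  have hn' : 0 < n.natAbs := Int.natAbs_pos.mpr hn
  have hyabs : y.natAbs = 2 * m.natAbs * n.natAbs := by simp [hym, Int.natAbs_mul]
  rcases hpq with ⟨hp, hq⟩ | ⟨hp, hq⟩
  · obtain ⟨x', y', a', b', hx', hc, hy', hle, h₁, h₂⟩ :=
      exists_smaller_concordant_pair hmn'.symm hn hm hq hp (by linarith) (by linarith)
    exact hy' (ih _ (by nlinarith) hx' hc h₁ h₂ rfl)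
  · obtain ⟨x', y', a', b', hx', hc, hy', hle, h₁, h₂⟩ :=
      exists_smaller_concordant_pair hmn' hm hn hp hq (by linarith) (by linarith)
    exact hy' (ih _ (by nlinarith) hx' hc h₁ h₂ rfl)

theorem eq_zero_or_eq_zero_of_concordant {x y a b : ℤ} (hxy : IsCoprime x y)
    (ha : x ^ 2 + y ^ 2 = a ^ 2) (hb : x ^ 2 + 4 * y ^ 2 = b ^ 2) : x = 0 ∨ y = 0 := by
  rcases Int.emod_two_eq_zero_or_one x with hx | hx
  · obtain ⟨z, rfl⟩ := Int.dvd_of_emod_eq_zero hx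
    obtain ⟨c, rfl⟩ : (2 : ℤ) ∣ b :=
      Int.prime_two.dvd_of_dvd_pow (n := 2) ⟨2 * z ^ 2 + 2 * y ^ 2, by linarith⟩
    have hy : y % 2 = 1 := by
      rcases Int.emod_two_eq_zero_or_one y with h | h
      · have := Int.isUnit_iff.mp
          (hxy.isUnit_of_dvd' (Dvd.intro z rfl) (Int.dvd_of_emod_eq_zero h))
        omega
      · exact h
    left
    rw [eq_zero_of_concordant_of_odd (a := c) (b := a) hy hxy.of_mul_left_right.symm
      (by linarith) (by linarith), mul_zero]
  · exact Or.inr (eq_zero_of_concordant_of_odd hx hxy ha hb)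

theorem exists_sq_eq_of_isCoprime_of_nonneg {x y t : ℤ} (hxy : IsCoprime x y) (hx : 0 ≤ x)
    (h : x * y = t ^ 2) : ∃ u, x = u ^ 2 := by
  obtain ⟨u, hu | hu⟩ := Int.sq_of_isCoprime hxy h
  · exact ⟨u, hu⟩
  · exact ⟨0, by nlinarith [sq_nonneg u]⟩

theorem integer_points_quartic_median {a b t : ℤ} (hab : IsCoprime a b)
    (h : t ^ 2 = (4 * a ^ 2 - b ^ 2) * (b ^ 2 - a ^ 2)) : b ^ 2 = a ^ 2 ∨ b ^ 2 = 4 * a ^ 2 := by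
  obtain ⟨hX, hY⟩ : 0 ≤ 4 * a ^ 2 - b ^ 2 ∧ 0 ≤ b ^ 2 - a ^ 2 := by
    constructor <;> by_contra! hneg <;> nlinarith [sq_nonneg a, sq_nonneg b, sq_nonneg t]
  by_cases h3 : 3 ∣ b ^ 2 - a ^ 2
  · obtain ⟨Y, hY'⟩ := h3
    have hX' : 4 * a ^ 2 - b ^ 2 = 3 * (a ^ 2 - Y) := by linarith
    obtain ⟨r, rfl⟩ : 3 ∣ t := by
      apply Int.prime_three.dvd_of_dvd_pow (n := 2)
      exact ⟨3 * (a ^ 2 - Y) * Y, by rw [h, hX', hY']; ring⟩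
    have hr : (a ^ 2 - Y) * Y = r ^ 2 := by
      rw [hX', hY'] at h
      linarith
    have hc : IsCoprime (a ^ 2 - Y) Y := by
      obtain ⟨s, w, hsw⟩ := hab.pow (m := 2) (n := 2)
      exact ⟨s + w, s + 4 * w, by linear_combination hsw - w * hY'⟩
    obtain ⟨u, hu⟩ := exists_sq_eq_of_isCoprime_of_nonneg hc (by linarith) hr
    obtain ⟨v, hv⟩ :=
      exists_sq_eq_of_isCoprime_of_nonneg hc.symm (by linarith) ((mul_comm _ _).trans hr)
    have huv : IsCoprime u v := by
      rw [hu, hv] at hc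
      exact (IsCoprime.pow_iff two_pos two_pos).mp hc
    rcases eq_zero_or_eq_zero_of_concordant (a := a) (b := b) huv (by linarith) (by linarith)
      with rfl | rfl
    · right
      linarith
    · left
      linarith
  · have hc : IsCoprime (4 * a ^ 2 - b ^ 2) (b ^ 2 - a ^ 2) := by
      have h3c : IsCoprime 3 (b ^ 2 - a ^ 2) := (Int.prime_three.coprime_iff_not_dvd).mpr h3
      have hac : IsCoprime (a ^ 2) (b ^ 2 - a ^ 2) := by
        obtain ⟨s, w, hsw⟩ := hab.pow (m := 2) (n := 2)
        exact ⟨s + w, w, by linear_combination hsw⟩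
      obtain ⟨s, w, hsw⟩ := h3c.mul_left hac
      exact ⟨s, s + w, by linear_combination hsw⟩
    obtain ⟨u, hu⟩ := exists_sq_eq_of_isCoprime_of_nonneg hc hX h.symm
    obtain ⟨v, hv⟩ :=
      exists_sq_eq_of_isCoprime_of_nonneg hc.symm hY ((mul_comm _ _).trans h.symm)
    obtain ⟨-, hv3⟩ :=
      three_dvd_and_three_dvd_of_three_dvd_sq_add_sq (x := u) (y := v) ⟨a ^ 2, by linarith⟩
    exact absurd (hv ▸ dvd_pow hv3 two_ne_zero) h3

/-- every rational solution of `s² = −4p⁴ + 5p² − 1`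
has `s = 0` and `p ∈ {±1, ±1/2}`. -/
theorem rational_points_quartic_median
    (p s : ℚ) (h : s ^ 2 = -4 * p ^ 4 + 5 * p ^ 2 - 1) :
    s = 0 ∧ (p = 1 ∨ p = -1 ∨ p = 1 / 2 ∨ p = -1 / 2) := by
  have hd : (p.den : ℚ) ≠ 0 := by exact_mod_cast p.den_nz
  have hp : p * p.den = p.num := Rat.mul_den_eq_num p
  have hab : IsCoprime p.num (p.den : ℤ) := by
    rw [Int.isCoprime_iff_gcd_eq_one]
    exact p.reduced
  have hsq : IsSquare
      ((4 * p.num ^ 2 - (p.den : ℤ) ^ 2) * ((p.den : ℤ) ^ 2 - p.num ^ 2)) := by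
    rw [← Rat.isSquare_intCast_iff]
    refine ⟨s * p.den ^ 2, ?_⟩
    push_cast
    rw [← hp]
    linear_combination (-(p.den : ℚ) ^ 4) * h
  obtain ⟨t, ht⟩ := hsq
  have hp2 : p ^ 2 = 1 ∨ p ^ 2 = (1 / 2) ^ 2 := by
    have hd2 := pow_ne_zero 2 hd
    rcases integer_points_quartic_median hab ((pow_two t).trans ht.symm) with hb | hb
    · left
      have hb' : (p.den : ℚ) ^ 2 = (p.num : ℚ) ^ 2 := by exact_mod_cast hb
      rw [← hp] at hb'
      apply mul_right_cancel₀ hd2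
      linear_combination -hb'
    · right
      have hb' : (p.den : ℚ) ^ 2 = 4 * (p.num : ℚ) ^ 2 := by exact_mod_cast hb
      rw [← hp] at hb'
      apply mul_right_cancel₀ hd2
      linear_combination -hb' / 4
  constructor
  · apply pow_eq_zero_iff two_ne_zero |>.mp
    rw [h]
    rcases hp2 with hp2 | hp2
    · linear_combination (-4 * p ^ 2 + 1) * hp2
    · linear_combination (-4 * p ^ 2 + 4) * hp2
  · rcases hp2 with hp2 | hp2
    · rcases sq_eq_sq_iff_eq_or_eq_neg.mp (hp2.trans (one_pow 2).symm) with h | h <;> simp [h]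
    · rcases sq_eq_sq_iff_eq_or_eq_neg.mp hp2 with h | h
      · exact Or.inr (Or.inr (Or.inl h))
      · exact Or.inr (Or.inr (Or.inr (by rw [h]; norm_num)))
end
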